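/- For every N ≥ 1 and every edge configuration ω on the two-dimensional torus T²_N, the rank of ω plus the rank of the dual configuration ω* equals 2: dim_ℚ span(winding vectors realized by ω) + dim_ℚ span(winding vectors realized by ω*) = 2. -/

import Mathlib

/-!
Bond percolation on the torus `T^d_N`.  A configuration assigns `true`/`false`
(open/closed) to each edge of the graph on `(ℤ/Nℤ)^d` in which a vertex is joined
to its translates by standard basis vectors; edges are indexed by a vertex together
with a direction.  A configuration lifts `N`-periodically to `ℤ^d`, and the
giant-cycle event `A^□` asks for two distinct points of `ℤ^d`, congruent mod `N`,
joined by a path of open edges of the periodic lift.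
-/

namespace TorusPerc

/-- The standard basis vector `e i` of `ℤ^d`. -/
def stdVec (d : ℕ) (i : Fin d) : Fin d → ℤ := fun j => if j = i then 1 else 0

/-- An edge of the cubical torus: a vertex of `(ℤ/Nℤ)^d` together with a direction. -/
abbrev Edge (d N : ℕ) := (Fin d → ZMod N) × Fin d

/-- A bond configuration on the torus. -/
abbrev Config (d N : ℕ) := Edge d N → Bool

/-- Reduction of a point of `ℤ^d` modulo `N`. -/
def proj (d N : ℕ) (x : Fin d → ℤ) : Fin d → ZMod N := fun i => (x i : ZMod N)

/-- The edge of the periodic lift going from `x` in direction `i` is open. -/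
def liftOpen (d N : ℕ) (ω : Config d N) (x : Fin d → ℤ) (i : Fin d) : Prop :=
  ω (proj d N x, i) = true

/-- One step along an open edge of the periodic lift. -/
def step (d N : ℕ) (ω : Config d N) (x y : Fin d → ℤ) : Prop :=
  (∃ i, y = x + stdVec d i ∧ liftOpen d N ω x i) ∨
  (∃ i, x = y + stdVec d i ∧ liftOpen d N ω y i)

/-- Connectivity by paths of open edges in the periodic lift. -/
def connected (d N : ℕ) (ω : Config d N) : (Fin d → ℤ) → (Fin d → ℤ) → Prop :=
  Relation.ReflTransGen (step d N ω)

/-- The giant-cycle event `A^□`: some two distinct points of `ℤ^d` which are congruent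
modulo `N` are joined by an open path of the periodic lift. -/
def giantEvent (d N : ℕ) : Set (Config d N) :=
  {ω | ∃ x y : Fin d → ℤ, x ≠ y ∧ proj d N x = proj d N y ∧ connected d N ω x y}

/-- The set of winding vectors realized by a configuration. -/
def winding (d N : ℕ) (ω : Config d N) : Set (Fin d → ℤ) :=
  {w | ∃ x : Fin d → ℤ, connected d N ω x (x + (N : ℤ) • w)}

/-- The realized winding vectors, regarded as vectors in `ℚ^d`. -/
def windingQ (d N : ℕ) (ω : Config d N) : Set (Fin d → ℚ) :=
  (fun w : Fin d → ℤ => fun i => (w i : ℚ)) '' winding d N ω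

/-- The spanning event `S^□`: the realized winding vectors span `ℚ^d`. -/
def spanEvent (d N : ℕ) : Set (Config d N) :=
  {ω | Submodule.span ℚ (windingQ d N ω) = ⊤}

/-- The probability of an event under Bernoulli(`p`) bond percolation on the torus:
each edge is open independently with probability `p`. -/
noncomputable def prob (d N : ℕ) (p : ℝ) (S : Set (Config d N)) : ℝ :=
  ∑ᶠ ω ∈ S, ∏ᶠ e : Edge d N, (if ω e then p else 1 - p)

end TorusPerc


namespace TorusPerc

/-- The dual configuration on the dual square torus lattice (whose vertices are the
vertices of `T²_N` shifted by `(1/2,1/2)`, a dual vertex `u` standing for the point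
`u + (1/2,1/2)`).  The dual edge from the dual vertex `u` in direction `i` crosses
exactly the primal edge from `u + e_i` in the direction `Fin.rev i`, and it is open
iff that primal edge is closed. -/
def dualConfig (N : ℕ) (ω : Config 2 N) : Config 2 N :=
  fun e => ! ω (e.1 + (fun j => if j = e.2 then (1 : ZMod N) else 0), e.2.rev)

/-- The rank of a configuration: the dimension over `ℚ` of the span of its realized
winding vectors. -/
noncomputable def rankOf (N : ℕ) (ω : Config 2 N) : ℕ :=
  Module.finrank ℚ ↥(Submodule.span ℚ (windingQ 2 N ω))

end TorusPerc

namespace TorusPerc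

/-- Basis vector on the torus. -/
def te (N : ℕ) (i : Fin 2) : Fin 2 → ZMod N := fun j => if j = i then 1 else 0

lemma proj_add_std (N : ℕ) (x : Fin 2 → ℤ) (i : Fin 2) :
    proj 2 N (x + stdVec 2 i) = proj 2 N x + te N i := by
  funext j
  simp only [proj, stdVec, te, Pi.add_apply]
  split_ifs <;> simp

lemma proj_add_smul (N : ℕ) (x w : Fin 2 → ℤ) :
    proj 2 N (x + (N : ℤ) • w) = proj 2 N x := by
  funext j
  simp [proj]

lemma exists_of_proj_eq (N : ℕ) (x y : Fin 2 → ℤ) (h : proj 2 N x = proj 2 N y) :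
    ∃ w : Fin 2 → ℤ, y = x + (N : ℤ) • w := by
  have h1 : ∀ i, ∃ c : ℤ, y i - x i = (N : ℤ) * c := by
    intro i
    have h2 := congrFun h i
    simp only [proj] at h2
    exact (ZMod.intCast_eq_intCast_iff_dvd_sub _ _ _).1 h2
  choose w hw using h1
  refine ⟨w, ?_⟩
  funext i
  have := hw i
  simp only [Pi.add_apply, Pi.smul_apply, smul_eq_mul]
  linarith

lemma step_symm (N : ℕ) (ω : Config 2 N) (x y : Fin 2 → ℤ) (h : step 2 N ω x y) :
    step 2 N ω y x := Or.symm h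

lemma conn_symm (N : ℕ) (ω : Config 2 N) {x y : Fin 2 → ℤ} (h : connected 2 N ω x y) :
    connected 2 N ω y x := by
  induction h with
  | refl => exact Relation.ReflTransGen.refl
  | tail _ hs ih => exact Relation.ReflTransGen.head (step_symm N ω _ _ hs) ih

lemma step_trans (N : ℕ) (ω : Config 2 N) (x y w : Fin 2 → ℤ) (h : step 2 N ω x y) :
    step 2 N ω (x + (N : ℤ) • w) (y + (N : ℤ) • w) := by
  rcases h with ⟨i, rfl, h⟩ | ⟨i, rfl, h⟩
  · refine Or.inl ⟨i, by abel, ?_⟩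
    simpa only [liftOpen, proj_add_smul] using h
  · refine Or.inr ⟨i, by abel, ?_⟩
    simpa only [liftOpen, proj_add_smul] using h

lemma conn_translate (N : ℕ) (ω : Config 2 N) {x y : Fin 2 → ℤ} (w : Fin 2 → ℤ)
    (h : connected 2 N ω x y) :
    connected 2 N ω (x + (N : ℤ) • w) (y + (N : ℤ) • w) := by
  induction h with
  | refl => exact Relation.ReflTransGen.refl
  | tail _ hs ih => exact Relation.ReflTransGen.tail ih (step_trans N ω _ _ w hs)

/-- Lying in the same component of the torus. -/
def sameComp (N : ℕ) (ω : Config 2 N) : Setoid (Fin 2 → ℤ) where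
  r x y := ∃ w : Fin 2 → ℤ, connected 2 N ω x (y + (N : ℤ) • w)
  iseqv := by
    refine ⟨fun x => ⟨0, ?_⟩, ?_, ?_⟩
    · simp only [smul_zero, add_zero]
      exact Relation.ReflTransGen.refl
    · rintro x y ⟨w, h⟩
      refine ⟨-w, ?_⟩
      have := conn_translate N ω (-w) (conn_symm N ω h)
      have e : y + (N : ℤ) • w + (N : ℤ) • (-w) = y := by
        rw [smul_neg]; abel
      rwa [e] at this
    · rintro x y z ⟨w, h⟩ ⟨w', h'⟩
      refine ⟨w' + w, ?_⟩
      have := conn_translate N ω w h'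
      rw [smul_add, ← add_assoc]
      exact Relation.ReflTransGen.trans h this

lemma exists_lift_potential (N : ℕ) (ω : Config 2 N) (φ : Fin 2 → ℚ)
    (hφ : ∀ w ∈ winding 2 N ω, φ 0 * (w 0 : ℚ) + φ 1 * (w 1 : ℚ) = 0) :
    ∃ F : (Fin 2 → ℤ) → ℚ, ∀ x y w : Fin 2 → ℤ, connected 2 N ω x (y + (N : ℤ) • w) →
      F y - F x = φ 0 * ((y 0 : ℚ) + N * w 0 - x 0) + φ 1 * ((y 1 : ℚ) + N * w 1 - x 1) := by
  let r : (Fin 2 → ℤ) → (Fin 2 → ℤ) := fun x => (Quotient.mk (sameComp N ω) x).out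
  have hr : ∀ x, ∃ w : Fin 2 → ℤ, connected 2 N ω (r x) (x + (N : ℤ) • w) :=
    fun x => Quotient.mk_out (s := sameComp N ω) x
  choose W hW using hr
  refine ⟨fun x => φ 0 * ((x 0 : ℚ) + N * W x 0 - r x 0) + φ 1 * ((x 1 : ℚ) + N * W x 1 - r x 1),
    ?_⟩
  intro x y w h
  have hxy : r x = r y := by
    have : Quotient.mk (sameComp N ω) x = Quotient.mk (sameComp N ω) y := Quotient.sound ⟨w, h⟩
    simp only [r, this]
  have h1 := hW x
  have h2 := hW y
  rw [← hxy] at h2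
  have h3 := conn_translate N ω (W x) h
  have h4 := Relation.ReflTransGen.trans (conn_symm N ω h2) (Relation.ReflTransGen.trans h1 h3)
  have h5 : w + W x - W y ∈ winding 2 N ω := by
    refine ⟨y + (N : ℤ) • W y, ?_⟩
    have e : y + (N : ℤ) • W y + (N : ℤ) • (w + W x - W y) =
      y + (N : ℤ) • w + (N : ℤ) • W x := by
      rw [smul_sub, smul_add]; abel
    rw [e]
    exact h4
  have h6 := hφ _ h5
  simp only [Pi.add_apply, Pi.sub_apply] at h6
  push_cast at h6
  simp only [hxy]
  linear_combination (-(N : ℚ)) * h6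

lemma exists_potential (N : ℕ) (ω : Config 2 N) (φ : Fin 2 → ℚ)
    (hφ : ∀ w ∈ winding 2 N ω, φ 0 * (w 0 : ℚ) + φ 1 * (w 1 : ℚ) = 0) :
    ∃ f : (Fin 2 → ZMod N) → ℚ, ∀ v i, ω (v, i) = true → f (v + te N i) - f v = φ i := by
  obtain ⟨F, hF⟩ := exists_lift_potential N ω φ hφ
  have hs : ∀ v : Fin 2 → ZMod N, ∃ x : Fin 2 → ℤ, proj 2 N x = v := by
    intro v
    choose x hx using fun i => ZMod.intCast_surjective (v i)
    exact ⟨x, funext hx⟩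
  choose L hL using hs
  have hper : ∀ x, F x = F (L (proj 2 N x)) := by
    intro x
    obtain ⟨w, hw⟩ := exists_of_proj_eq N (L (proj 2 N x)) x (hL _)
    have h1 : connected 2 N ω x (L (proj 2 N x) + (N : ℤ) • w) := by
      rw [← hw]; exact Relation.ReflTransGen.refl
    have h2 := hF _ _ _ h1
    have a0 : (x 0 : ℚ) = L (proj 2 N x) 0 + N * w 0 := by
      have := congrFun hw 0
      simp only [Pi.add_apply, Pi.smul_apply, smul_eq_mul] at this
      exact_mod_cast this
    have a1 : (x 1 : ℚ) = L (proj 2 N x) 1 + N * w 1 := by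
      have := congrFun hw 1
      simp only [Pi.add_apply, Pi.smul_apply, smul_eq_mul] at this
      exact_mod_cast this
    linear_combination -h2 + φ 0 * a0 + φ 1 * a1
  refine ⟨fun v => F (L v), ?_⟩
  intro v i hv
  have hc : connected 2 N ω (L v) (L v + stdVec 2 i + (N : ℤ) • (0 : Fin 2 → ℤ)) := by
    rw [smul_zero, add_zero]
    refine Relation.ReflTransGen.single (Or.inl ⟨i, rfl, ?_⟩)
    simpa only [liftOpen, hL] using hv
  have h1 := hF _ _ _ hc
  have h2 := hper (L v + stdVec 2 i)
  rw [proj_add_std, hL] at h2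
  try simp only
  rw [← h2, h1]
  fin_cases i <;> simp [stdVec]

lemma sum_shift (N : ℕ) [NeZero N] (g : (Fin 2 → ZMod N) → ℚ) (a : Fin 2 → ZMod N) :
    ∑ u, g (u + a) = ∑ u, g u :=
  Fintype.sum_equiv (Equiv.addRight a) _ _ (fun _ => rfl)

lemma lower (N : ℕ) [NeZero N] (ω : Config 2 N) (φ ψ : Fin 2 → ℚ)
    (hφ : ∀ w ∈ winding 2 N ω, φ 0 * (w 0 : ℚ) + φ 1 * (w 1 : ℚ) = 0)
    (hψ : ∀ w ∈ winding 2 N (dualConfig N ω), ψ 0 * (w 0 : ℚ) + ψ 1 * (w 1 : ℚ) = 0) :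
    φ 0 * ψ 1 - φ 1 * ψ 0 = 0 := by
  obtain ⟨f, hf⟩ := exists_potential N ω φ hφ
  obtain ⟨g, hg⟩ := exists_potential N _ ψ hψ
  have hd : ∀ u i, f (u + te N i + te N i.rev) - f (u + te N i) = φ i.rev ∨
      g (u + te N i) - g u = ψ i := by
    intro u i
    by_cases h : ω (u + te N i, i.rev) = true
    · exact Or.inl (hf _ _ h)
    · right
      apply hg
      have h' : ω (u + te N i, i.rev) = false := by simpa using h
      change (! ω (u + te N i, i.rev)) = true
      rw [h']; rfl
  have r0 : (0 : Fin 2).rev = 1 := rfl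
  have r1 : (1 : Fin 2).rev = 0 := rfl
  have k0 : ∀ u, (φ 1 - (f (u + te N 0 + te N 1) - f (u + te N 0))) *
      (ψ 0 - (g (u + te N 0) - g u)) = 0 := by
    intro u
    rcases hd u 0 with h | h
    · rw [r0] at h; rw [h]; ring
    · rw [h]; ring
  have k1 : ∀ u, (φ 0 - (f (u + te N 0 + te N 1) - f (u + te N 1))) *
      (ψ 1 - (g (u + te N 1) - g u)) = 0 := by
    intro u
    have e : u + te N 0 + te N 1 = u + te N 1 + te N 0 := by abel
    rw [e]
    rcases hd u 1 with h | h
    · rw [r1] at h; rw [h]; ring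
    · rw [h]; ring
  have S : ∑ u : Fin 2 → ZMod N, (((φ 0 - (f (u + te N 0 + te N 1) - f (u + te N 1))) *
      (ψ 1 - (g (u + te N 1) - g u))) - (φ 1 - (f (u + te N 0 + te N 1) - f (u + te N 0))) *
      (ψ 0 - (g (u + te N 0) - g u))) = 0 := by
    apply Finset.sum_eq_zero
    intro u _
    rw [k0, k1]; ring
  have e01 : te N 0 + te N 1 = te N 1 + te N 0 := add_comm _ _
  have T : ∑ u : Fin 2 → ZMod N, (((φ 0 - (f (u + te N 0 + te N 1) - f (u + te N 1))) *
      (ψ 1 - (g (u + te N 1) - g u))) - (φ 1 - (f (u + te N 0 + te N 1) - f (u + te N 0))) *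
      (ψ 0 - (g (u + te N 0) - g u))) =
      ∑ u : Fin 2 → ZMod N, (φ 0 * ψ 1 - φ 1 * ψ 0) := by
    have sf1 := sum_shift N f (te N 1)
    have sf0 := sum_shift N f (te N 0)
    have sf01 := sum_shift N f (te N 0 + te N 1)
    have sg1 := sum_shift N g (te N 1)
    have sg0 := sum_shift N g (te N 0)
    have sa := sum_shift N (fun u => f u * g u) (te N 0)
    have sb := sum_shift N (fun u => f u * g u) (te N 1)
    have sc := sum_shift N (fun u => f (u + te N 0) * g u) (te N 1)
    have sd := sum_shift N (fun u => f (u + te N 1) * g u) (te N 0)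
    simp only [← add_assoc] at sf01
    have e2 : ∀ u, u + te N 1 + te N 0 = u + te N 0 + te N 1 := fun u => by abel
    simp only [e2] at sc
    simp only [mul_sub, sub_mul, Finset.sum_sub_distrib, ← Finset.mul_sum, ← Finset.sum_mul,
      sf1, sf0, sf01, sg1, sg0, sa, sb, sc, sd]
    ring
  rw [S] at T
  simp only [Finset.sum_const, Finset.card_univ, nsmul_eq_mul] at T
  have hc : (Fintype.card (Fin 2 → ZMod N) : ℚ) ≠ 0 := by
    exact_mod_cast Fintype.card_ne_zero
  rcases mul_eq_zero.1 T.symm with h | h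
  · exact absurd h hc
  · exact h

/-- A path produces a flow. -/
lemma exists_flow (N : ℕ) [NeZero N] (ω : Config 2 N) (x y : Fin 2 → ℤ)
    (h : connected 2 N ω x y) :
    ∃ j : Fin 2 → (Fin 2 → ZMod N) → ℚ, (∀ u i, ω (u, i) = false → j i u = 0) ∧
      (∀ i, ∑ u, j i u = (y i : ℚ) - x i) ∧
      (∀ u, (j 0 (u + te N 0 + te N 1) - j 0 (u + te N 1)) +
        (j 1 (u + te N 0 + te N 1) - j 1 (u + te N 0)) =
        (if u + te N 0 + te N 1 = proj 2 N x then 1 else 0) -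
        (if u + te N 0 + te N 1 = proj 2 N y then 1 else 0)) := by
  have aux : ∀ (j : Fin 2 → (Fin 2 → ZMod N) → ℚ) (a : Fin 2 → ℤ) (k : Fin 2) (c : ℚ)
      (_ : liftOpen 2 N ω a k) (_ : ∀ u i, ω (u, i) = false → j i u = 0),
      ∃ j' : Fin 2 → (Fin 2 → ZMod N) → ℚ, (∀ u i, ω (u, i) = false → j' i u = 0) ∧
      (∀ i, ∑ u, j' i u = ∑ u, j i u + c * stdVec 2 k i) ∧
      (∀ u, (j' 0 (u + te N 0 + te N 1) - j' 0 (u + te N 1)) +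
        (j' 1 (u + te N 0 + te N 1) - j' 1 (u + te N 0)) =
        (j 0 (u + te N 0 + te N 1) - j 0 (u + te N 1)) +
        (j 1 (u + te N 0 + te N 1) - j 1 (u + te N 0)) +
        c * ((if u + te N 0 + te N 1 = proj 2 N a then 1 else 0) -
        (if u + te N 0 + te N 1 = proj 2 N (a + stdVec 2 k) then 1 else 0))) := by
    intro j a k c ha hj
    refine ⟨fun i u => j i u + if i = k then (if u = proj 2 N a then c else 0) else 0,
      ?_, ?_, ?_⟩
    · intro u i hu
      simp only [hj u i hu, zero_add]
      by_cases h1 : i = k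
      · by_cases h2 : u = proj 2 N a
        · subst h1 h2
          simp only [liftOpen] at ha
          rw [ha] at hu
          exact absurd hu (by decide)
        · simp [h2]
      · simp [h1]
    · intro i
      rw [Finset.sum_add_distrib]
      by_cases h1 : i = k
      · simp [h1, stdVec]
      · simp [h1, stdVec]
    · intro u
      rw [proj_add_std]
      have e0 : u + te N 0 + te N 1 = proj 2 N a + te N 0 ↔ u + te N 1 = proj 2 N a := by
        rw [show u + te N 0 + te N 1 = u + te N 1 + te N 0 by abel, add_left_inj]
      have e1 : u + te N 0 + te N 1 = proj 2 N a + te N 1 ↔ u + te N 0 = proj 2 N a := by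
        rw [add_left_inj]
      fin_cases k
      · simp only [Fin.zero_eta, e0]
        simp only [if_true, one_ne_zero, if_false]
        split_ifs <;> ring
      · simp only [Fin.mk_one, e1]
        simp only [if_true, zero_ne_one, if_false]
        split_ifs <;> ring
  induction h with
  | refl => exact ⟨fun _ _ => 0, by simp, by simp, by simp⟩
  | @tail b y _ hs ih =>
    obtain ⟨j, h1, h2, h3⟩ := ih
    rcases hs with ⟨k, rfl, hk⟩ | ⟨k, rfl, hk⟩
    · obtain ⟨j', g1, g2, g3⟩ := aux j _ k 1 hk h1
      refine ⟨j', g1, ?_, ?_⟩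
      · intro i
        rw [g2, h2]; simp only [Pi.add_apply]; push_cast; ring
      · intro u
        rw [g3, h3]; ring
    · obtain ⟨j', g1, g2, g3⟩ := aux j _ k (-1) hk h1
      refine ⟨j', g1, ?_, ?_⟩
      · intro i
        rw [g2, h2]; simp only [Pi.add_apply]; push_cast; ring
      · intro u
        rw [g3, h3]; ring

lemma antideriv (g : ℤ → ℚ) : ∃ G : ℤ → ℚ, ∀ n, G (n + 1) - G n = g n := by
  refine ⟨fun n => ∑ i ∈ Finset.Ico 0 n, g i - ∑ i ∈ Finset.Ico n 0, g i, ?_⟩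
  intro n
  rcases le_or_gt 0 n with h | h
  · have e : Finset.Ico 0 (n + 1) = insert n (Finset.Ico 0 n) := by
      ext i; simp only [Finset.mem_Ico, Finset.mem_insert]; omega
    have e1 : Finset.Ico (n + 1) 0 = ∅ := Finset.Ico_eq_empty (by omega)
    have e2 : Finset.Ico n 0 = ∅ := Finset.Ico_eq_empty (by omega)
    simp only [e, e1, e2]
    rw [Finset.sum_insert (by simp)]
    simp
  · have e : Finset.Ico n 0 = insert n (Finset.Ico (n + 1) 0) := by
      ext i; simp only [Finset.mem_Ico, Finset.mem_insert]; omega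
    have e1 : Finset.Ico 0 (n + 1) = ∅ := Finset.Ico_eq_empty (by omega)
    have e2 : Finset.Ico 0 n = ∅ := Finset.Ico_eq_empty (by omega)
    simp only [e, e1, e2]
    rw [Finset.sum_insert (by simp)]
    simp

lemma const_of_diff (G : ℤ → ℚ) (h : ∀ n, G (n + 1) = G n) (n : ℤ) : G n = G 0 := by
  induction n using Int.induction_on with
  | zero => rfl
  | succ n ih => rw [h, ih]
  | pred n ih =>
    have := h (-(n : ℤ) - 1)
    rw [sub_add_cancel] at this
    rw [← this, ih]

lemma potential2 (p q : ℤ → ℤ → ℚ)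
    (h : ∀ a b, p a b + q (a + 1) b = q a b + p a (b + 1)) :
    ∃ F : ℤ → ℤ → ℚ, (∀ a b, F (a + 1) b - F a b = p a b) ∧
      (∀ a b, F a (b + 1) - F a b = q a b) := by
  obtain ⟨P, hP⟩ := antideriv (fun a => p a 0)
  choose Q hQ using fun a => antideriv (q a)
  refine ⟨fun a b => P a + (Q a b - Q a 0), ?_, ?_⟩
  · intro a b
    have := const_of_diff (fun b => P (a + 1) + (Q (a + 1) b - Q (a + 1) 0) -
      (P a + (Q a b - Q a 0)) - p a b) (by
        intro n
        try simp only
        linear_combination hQ (a + 1) n - hQ a n + h a n) b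
    linear_combination this + hP a
  · intro a b
    linear_combination hQ a b

lemma sum_zmod (N : ℕ) [NeZero N] (g : ZMod N → ℚ) :
    ∑ a, g a = ∑ k ∈ Finset.range N, g (k : ℕ) := by
  symm
  refine Finset.sum_bij (fun (k : ℕ) _ => (k : ZMod N)) ?_ ?_ ?_ ?_
  · simp
  · intro a ha b hb hab
    simp only [Finset.mem_range] at ha hb
    have := congrArg ZMod.val hab
    rwa [ZMod.val_natCast_of_lt ha, ZMod.val_natCast_of_lt hb] at this
  · intro b _
    exact ⟨b.val, by simpa using ZMod.val_lt b, by simp⟩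
  · simp

lemma telescope (G : ℤ → ℚ) (N : ℕ) (c : ℤ) :
    ∑ k ∈ Finset.range N, (G (c + k + 1) - G (c + k)) = G (c + N) - G c := by
  induction N with
  | zero => simp
  | succ n ih =>
    rw [Finset.sum_range_succ, ih]
    push_cast
    rw [show c + ((n : ℤ) + 1) = c + n + 1 by ring]
    ring

lemma upper (N : ℕ) [NeZero N] (ω : Config 2 N) (w w' : Fin 2 → ℤ)
    (hw : w ∈ winding 2 N ω) (hw' : w' ∈ winding 2 N (dualConfig N ω)) :
    (w 0 : ℚ) * w' 1 - w 1 * w' 0 = 0 := by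
  obtain ⟨x, hx⟩ := hw
  obtain ⟨x', hx'⟩ := hw'
  obtain ⟨j, j1, j2, j3⟩ := exists_flow N _ _ _ hx'
  simp only [proj_add_smul, sub_self] at j3
  -- torus cochain `t i v`, torus point `pt a b`
  let pt : ℤ → ℤ → (Fin 2 → ZMod N) := fun a b => ![(a : ZMod N), (b : ZMod N)]
  have pt0 : ∀ a b, pt (a + 1) b = pt a b + te N 0 := by
    intro a b; funext i; fin_cases i <;> simp [pt, te]
  have pt1 : ∀ a b, pt a (b + 1) = pt a b + te N 1 := by
    intro a b; funext i; fin_cases i <;> simp [pt, te]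
  have ptp : ∀ z : Fin 2 → ℤ, proj 2 N z = pt (z 0) (z 1) := by
    intro z; funext i; fin_cases i <;> simp [pt, proj]
  obtain ⟨F, hF0, hF1⟩ := potential2 (fun a b => - j 1 (pt a b - te N 1))
    (fun a b => j 0 (pt a b - te N 0)) (by
      intro a b
      have := j3 (pt a b - te N 0 - te N 1)
      rw [show pt a b - te N 0 - te N 1 + te N 0 + te N 1 = pt a b by abel,
        show pt a b - te N 0 - te N 1 + te N 1 = pt a b - te N 0 by abel,
        show pt a b - te N 0 - te N 1 + te N 0 = pt a b - te N 1 by abel] at this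
      simp only [pt0, pt1, add_sub_cancel_right]
      linear_combination this)
  -- F is constant along open edges
  have hstep : ∀ (a : Fin 2 → ℤ) (k : Fin 2), liftOpen 2 N ω a k →
      F ((a + stdVec 2 k) 0) ((a + stdVec 2 k) 1) = F (a 0) (a 1) := by
    intro a k ha
    have hz : j k.rev (proj 2 N a - te N k.rev) = 0 := by
      apply j1
      simp only [dualConfig, Fin.rev_rev]
      have e : (proj 2 N a - te N k.rev + fun j => if j = k.rev then (1 : ZMod N) else 0) =
        proj 2 N a := by
        change proj 2 N a - te N k.rev + te N k.rev = _
        abel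
      rw [e]
      simp only [liftOpen] at ha
      rw [ha]; rfl
    rw [ptp] at hz
    fin_cases k
    · have := hF0 (a 0) (a 1)
      have hz' : j 1 (pt (a 0) (a 1) - te N 1) = 0 := hz
      rw [hz'] at this
      simp [stdVec]
      linarith
    · have := hF1 (a 0) (a 1)
      have hz' : j 0 (pt (a 0) (a 1) - te N 0) = 0 := hz
      rw [hz'] at this
      simp [stdVec]
      linarith
  have hcon : ∀ y, connected 2 N ω x y → F (y 0) (y 1) = F (x 0) (x 1) := by
    intro y hy
    induction hy with
    | refl => rfl
    | tail _ hs ih =>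
      rcases hs with ⟨k, rfl, hk⟩ | ⟨k, rfl, hk⟩
      · rw [hstep _ _ hk, ih]
      · rw [← hstep _ _ hk, ih]
  have hend := hcon _ hx
  -- periods
  have ptper : ∀ a b m n : ℤ, pt (a + N * m) (b + N * n) = pt a b := by
    intro a b m n; funext i; fin_cases i <;> simp [pt]
  have hD : ∀ m n a b : ℤ, F (a + N * m) (b + N * n) - F a b = F (N * m) (N * n) - F 0 0 := by
    intro m n a b
    have s1 := const_of_diff (fun a => F (a + N * m) (b + N * n) - F a b) (by
      intro a
      have u1 := hF0 (a + N * m) (b + N * n)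
      have u2 := hF0 a b
      simp only [ptper] at u1
      try simp only
      rw [show a + 1 + (N : ℤ) * m = a + N * m + 1 by ring]
      linear_combination u1 - u2) a
    have s2 := const_of_diff (fun b => F (0 + N * m) (b + N * n) - F 0 b) (by
      intro b
      have u1 := hF1 (0 + N * m) (b + N * n)
      have u2 := hF1 0 b
      simp only [ptper] at u1
      try simp only
      rw [show b + 1 + (N : ℤ) * n = b + N * n + 1 by ring]
      linear_combination u1 - u2) b
    rw [s1, s2]
    simp
  have hlin0 : ∀ m : ℤ, F (N * m) 0 - F 0 0 = m * (F N 0 - F 0 0) := by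
    intro m
    have := const_of_diff (fun m => F (N * m) 0 - F 0 0 - m * (F N 0 - F 0 0)) (by
      intro m
      have := hD 1 0 (N * m) 0
      simp only [mul_one, mul_zero, add_zero] at this
      try simp only
      rw [show (N : ℤ) * (m + 1) = N * m + N by ring]
      push_cast
      linear_combination this) m
    simp at this
    linear_combination this
  have hlin1 : ∀ m : ℤ, F 0 (N * m) - F 0 0 = m * (F 0 N - F 0 0) := by
    intro m
    have := const_of_diff (fun m => F 0 (N * m) - F 0 0 - m * (F 0 N - F 0 0)) (by
      intro m
      have := hD 0 1 0 (N * m)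
      simp only [mul_one, mul_zero, add_zero] at this
      try simp only
      rw [show (N : ℤ) * (m + 1) = N * m + N by ring]
      push_cast
      linear_combination this) m
    simp at this
    linear_combination this
  have key : (w 0 : ℚ) * (F N 0 - F 0 0) + w 1 * (F 0 N - F 0 0) = 0 := by
    have a1 := hD (w 0) (w 1) (x 0) (x 1)
    have a2 := hD (w 0) 0 0 (N * w 1)
    simp only [mul_zero, add_zero, zero_add] at a2
    simp only [Pi.add_apply, Pi.smul_apply, smul_eq_mul] at hend
    linear_combination hend - a1 - a2 - hlin0 (w 0) - hlin1 (w 1)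
  have hNz : (N : ℚ) ≠ 0 := by exact_mod_cast NeZero.ne N
  have sumpt : ∀ g : (Fin 2 → ZMod N) → ℚ,
      ∑ u, g u = ∑ a ∈ Finset.range N, ∑ b ∈ Finset.range N, g (pt a b) := by
    intro g
    rw [Fintype.sum_equiv (finTwoArrowEquiv (ZMod N)) g (fun p => g ![p.1, p.2])
      (by intro u; congr 1; funext i; fin_cases i <;> simp [finTwoArrowEquiv]),
      Fintype.sum_prod_type, sum_zmod]
    refine Finset.sum_congr rfl fun a _ => ?_
    rw [sum_zmod]
    simp [pt]
  have c0 : F N 0 - F 0 0 = - (w' 1 : ℚ) := by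
    have t1 := j2 1
    rw [← sum_shift N (j 1) (-te N 1), sumpt, Finset.sum_comm] at t1
    have t2 : ∀ b ∈ Finset.range N, ∑ a ∈ Finset.range N, j 1 (pt a b + -te N 1) =
        -(F N 0 - F 0 0) := by
      intro b _
      have t3 := telescope (fun a => F a b) N 0
      have t4 := hD 1 0 0 b
      simp only [mul_one, mul_zero, add_zero, zero_add] at t4
      simp only [hF0, zero_add, Finset.sum_neg_distrib, sub_eq_add_neg (pt _ _)] at t3
      linear_combination -t3 - t4
    rw [Finset.sum_congr rfl t2] at t1
    simp at t1
    apply mul_left_cancel₀ hNz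
    linear_combination -t1
  have c1 : F 0 N - F 0 0 = (w' 0 : ℚ) := by
    have t1 := j2 0
    rw [← sum_shift N (j 0) (-te N 0), sumpt] at t1
    have t2 : ∀ a ∈ Finset.range N, ∑ b ∈ Finset.range N, j 0 (pt a b + -te N 0) =
        (F 0 N - F 0 0) := by
      intro a _
      have t3 := telescope (fun b => F a b) N 0
      have t4 := hD 0 1 a 0
      simp only [mul_one, mul_zero, add_zero, zero_add] at t4
      simp only [hF1, zero_add, sub_eq_add_neg (pt _ _)] at t3
      linear_combination t3 + t4
    rw [Finset.sum_congr rfl t2] at t1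
    simp at t1
    apply mul_left_cancel₀ hNz
    linear_combination t1
  rw [c0, c1] at key
  linear_combination -key

/-- The determinant form. -/
def detForm : LinearMap.BilinForm ℚ (Fin 2 → ℚ) :=
  LinearMap.mk₂ ℚ (fun x y => x 0 * y 1 - x 1 * y 0)
    (by intros; simp; ring) (by intros; simp; ring)
    (by intros; simp; ring) (by intros; simp; ring)

lemma detForm_apply (x y : Fin 2 → ℚ) : detForm x y = x 0 * y 1 - x 1 * y 0 := rfl

lemma detForm_refl : detForm.IsRefl := by
  intro x y h
  rw [detForm_apply] at h ⊢
  linarith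

lemma detForm_nondeg : detForm.Nondegenerate := by
  refine (LinearMap.IsRefl.nondegenerate_iff_separatingLeft detForm_refl).2 ?_
  intro x h
  have h0 := h ![1, 0]
  have h1 := h ![0, 1]
  simp [detForm_apply] at h0 h1
  funext i
  fin_cases i
  · exact h1
  · exact h0

lemma dual_span_eq (N : ℕ) [NeZero N] (ω : Config 2 N) :
    Submodule.span ℚ (windingQ 2 N (dualConfig N ω)) =
      detForm.orthogonal (Submodule.span ℚ (windingQ 2 N ω)) := by
  apply le_antisymm
  · rw [Submodule.span_le]
    rintro _ ⟨w', hw', rfl⟩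
    intro v hv
    change detForm v _ = 0
    induction hv using Submodule.span_induction with
    | mem v hv =>
      obtain ⟨w, hw, rfl⟩ := hv
      exact upper N ω w w' hw hw'
    | zero => simp
    | add a b _ _ ha hb => simp [ha, hb]
    | smul c a _ ha => simp [ha]
  · rw [← LinearMap.BilinForm.orthogonal_orthogonal detForm_nondeg detForm_refl
      (Submodule.span ℚ (windingQ 2 N (dualConfig N ω)))]
    intro φ hφ ψ hψ
    rw [detForm_apply]
    have := lower N ω ![-φ 1, φ 0] ![-ψ 1, ψ 0]
      (by
        intro w hw
        have := hφ _ (Submodule.subset_span ⟨w, hw, rfl⟩)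
        rw [detForm_apply] at this
        simp
        linarith)
      (by
        intro w hw
        have := hψ _ (Submodule.subset_span ⟨w, hw, rfl⟩)
        rw [detForm_apply] at this
        simp
        linarith)
    simp at this
    linarith

end TorusPerc

/-- For every `N ≥ 1` and every edge configuration `ω` on the two-dimensional torus
`T²_N`, the rank of `ω` plus the rank of the dual configuration `ω*` equals `2`. -/
theorem torus2_rank_add_dual_rank (N : ℕ) (hN : 1 ≤ N) (ω : TorusPerc.Config 2 N) :
    TorusPerc.rankOf N ω + TorusPerc.rankOf N (TorusPerc.dualConfig N ω) = 2 := by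
  have : NeZero N := ⟨by omega⟩
  unfold TorusPerc.rankOf
  rw [TorusPerc.dual_span_eq,
    LinearMap.BilinForm.finrank_orthogonal TorusPerc.detForm_nondeg]
  have h := Submodule.finrank_le (Submodule.span ℚ (TorusPerc.windingQ 2 N ω))
  simp only [Module.finrank_fin_fun] at h ⊢
  omega
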